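/- Let φ ∈ A and let O be an open subset of M such that φ(x) > u_+(x) for all x ∈ M∖O. Then there exists t₁ > 0 (depending on φ and O) such that T_t^−φ(x) = inf_{y∈O} h_{y,φ(y)}(x,t) for all x ∈ M and all t ≥ t₁. -/

import Mathlib

/-- Localization of the infimum in the representation of `T_t⁻φ` for large times:
if `φ ∈ A` (i.e. `φ` continuous, `φ ≥ u₊` everywhere with equality somewhere) and `O`
is an open set with `φ > u₊` on `M∖O`, then there is `t₁ > 0` such that
`T_t⁻φ(x) = inf_{y∈O} h_{y,φ(y)}(x,t)` for all `x ∈ M` and `t ≥ t₁`.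
Context facts: `T_t⁻φ(x) = inf_{y∈M} h_{y,φ(y)}(x,t)`; `h` is monotone in the value
variable; for `φ ∈ A`, `T_t⁻φ` is bounded on `M × [0,∞)`; for `ψ` with
`min(ψ − u₊) > 0`, `T_t⁻ψ → +∞` uniformly. -/
theorem Tminus_inf_localizes_on_open_set
    (M : Type*) [MetricSpace M] [CompactSpace M] [Nonempty M]
    (T : ℝ → (M → ℝ) → M → ℝ) (h : M → ℝ → M → ℝ → ℝ)
    (uplus : M → ℝ) (huplus : Continuous uplus)
    (hrep : ∀ φ : M → ℝ, Continuous φ → ∀ t : ℝ, 0 < t → ∀ x,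
      T t φ x = ⨅ y : M, h y (φ y) x t)
    (hmono : ∀ (x₀ x : M) (t : ℝ), 0 < t → Monotone (fun u : ℝ => h x₀ u x t))
    (hbdd : ∀ φ : M → ℝ, Continuous φ → (∀ x, uplus x ≤ φ x) → (∃ x, φ x = uplus x) →
      ∃ K : ℝ, ∀ t : ℝ, 0 ≤ t → ∀ x : M, |T t φ x| ≤ K)
    (hdiv : ∀ ψ : M → ℝ, Continuous ψ → (∀ x, uplus x < ψ x) →
      ∀ C : ℝ, ∃ t₀ : ℝ, ∀ t ≥ t₀, ∀ x : M, C ≤ T t ψ x)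
    (φ : M → ℝ) (hφc : Continuous φ)
    (hφge : ∀ x, uplus x ≤ φ x) (hφeq : ∃ x, φ x = uplus x)
    (O : Set M) (hO : IsOpen O)
    (hgt : ∀ x ∉ O, uplus x < φ x) :
    ∃ t₁ : ℝ, 0 < t₁ ∧ ∀ x : M, ∀ t ≥ t₁, T t φ x = ⨅ y : O, h y (φ y) x t := by
  obtain ⟨δ, hδ, hδle⟩ : ∃ δ : ℝ, 0 < δ ∧ ∀ y ∈ Oᶜ, δ ≤ φ y - uplus y :=
    hO.isClosed_compl.isCompact.exists_forall_le' (hφc.sub huplus).continuousOn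
      (fun y hy => sub_pos.mpr (hgt y hy))
  obtain ⟨K, hK⟩ := hbdd φ hφc hφge hφeq
  have hψc : Continuous (fun y => uplus y + δ) := huplus.add continuous_const
  obtain ⟨t₀, ht₀⟩ := hdiv (fun y => uplus y + δ) hψc (fun y => by linarith) (|K| + 1)
  refine ⟨max t₀ 1, lt_of_lt_of_le one_pos (le_max_right _ _), fun x t ht => ?_⟩
  have htt : t₀ ≤ t := (le_max_left _ _).trans ht
  have ht1 : 0 < t := lt_of_lt_of_le one_pos ((le_max_right _ _).trans ht)
  have hO0 : Nonempty O := by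
    obtain ⟨z, hz⟩ := hφeq
    refine ⟨⟨z, ?_⟩⟩
    by_contra hzO
    exact absurd hz (hgt z hzO).ne'
  have hψ := ht₀ t htt x
  rw [hrep _ hψc t ht1 x] at hψ
  have hψb : BddBelow (Set.range fun y => h y (uplus y + δ) x t) := by
    by_contra hb
    rw [Real.iInf_of_not_bddBelow hb] at hψ
    linarith [abs_nonneg K]
  have hoff : ∀ y ∉ O, |K| + 1 ≤ h y (φ y) x t := fun y hy =>
    (hψ.trans (ciInf_le hψb y)).trans
      (hmono y x t ht1 (by linarith [hδle y hy]))
  have hTK : T t φ x < |K| + 1 := by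
    linarith [le_abs_self (T t φ x), hK t ht1.le x, le_abs_self K]
  rw [hrep φ hφc t ht1 x] at hTK ⊢
  by_cases hb : BddBelow (Set.range fun y => h y (φ y) x t)
  · have hbO : BddBelow (Set.range fun y : O => h y (φ y) x t) :=
      hb.mono (by rintro _ ⟨y, rfl⟩; exact ⟨y, rfl⟩)
    apply le_antisymm
    · exact le_ciInf fun y => ciInf_le hb (y : M)
    · refine le_ciInf fun y => ?_
      by_cases hy : y ∈ O
      · exact ciInf_le hbO ⟨y, hy⟩
      · obtain ⟨z, hz⟩ := exists_lt_of_ciInf_lt hTK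
        have hzO : z ∈ O := by
          by_contra hzO
          exact absurd (hoff z hzO) (not_le.mpr hz)
        exact (ciInf_le hbO ⟨z, hzO⟩).trans (hz.le.trans (hoff y hy))
  · have hbO : ¬ BddBelow (Set.range fun y : O => h y (φ y) x t) := by
      rintro ⟨m, hm⟩
      refine hb ⟨min m (|K| + 1), ?_⟩
      rintro _ ⟨y, rfl⟩
      by_cases hy : y ∈ O
      · exact (min_le_left _ _).trans (hm ⟨⟨y, hy⟩, rfl⟩)
      · exact (min_le_right _ _).trans (hoff y hy)
    rw [Real.iInf_of_not_bddBelow hb, Real.iInf_of_not_bddBelow hbO]
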